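/- For every real α > 0, every integer k ∈ ℤ, and every x ∈ ℝ, the rational basis functions are eigenfunctions of the principal-value Hilbert transform: the function ε ↦ ∫_{y ∈ ℝ : |x − y| > ε} ρ_k(y)/(x − y) dy tends, as ε → 0 from the right, to −i·π·σ(k)·ρ_k(x), where σ(k) = 1 if k ≥ 0 and σ(k) = −1 if k < 0. (Equivalently, with the normalization H f(x) = (1/π) p.v. ∫ f(y)/(x−y) dy, one has H ρ_k = −i·sgn(k)·ρ_k with the convention sgn(0) = 1.) -/

import Mathlib

open MeasureTheory Filter

/-- The rational basis function `ρ_k(x) = (α + i x)^k / (α - i x)^(k+1)` (integer powers). -/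
noncomputable def rho (α : ℝ) (k : ℤ) (x : ℝ) : ℂ :=
  ((α : ℂ) + Complex.I * x) ^ k / ((α : ℂ) - Complex.I * x) ^ (k + 1)

open Topology

lemma add_I_mul_ne_zero {α : ℝ} (hα : 0 < α) (y : ℝ) : (α : ℂ) + Complex.I * y ≠ 0 := by
  intro h
  have := congrArg Complex.re h
  simp at this
  exact hα.ne' this

lemma sub_I_mul_ne_zero {α : ℝ} (hα : 0 < α) (y : ℝ) : (α : ℂ) - Complex.I * y ≠ 0 := by
  intro h
  have := congrArg Complex.re h
  simp at this
  exact hα.ne' this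

lemma norm_add_I_mul (α y : ℝ) : ‖(α : ℂ) + Complex.I * y‖ = √(α ^ 2 + y ^ 2) := by
  rw [mul_comm, Complex.norm_add_mul_I]

lemma norm_sub_I_mul (α y : ℝ) : ‖(α : ℂ) - Complex.I * y‖ = √(α ^ 2 + y ^ 2) := by
  have := norm_add_I_mul α (-y)
  simpa [sub_eq_add_neg] using this

lemma norm_rho {α : ℝ} (hα : 0 < α) (k : ℤ) (y : ℝ) :
    ‖rho α k y‖ = (√(α ^ 2 + y ^ 2))⁻¹ := by
  have h : √(α ^ 2 + y ^ 2) ≠ 0 := by positivity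
  rw [rho, norm_div, norm_zpow, norm_zpow, norm_add_I_mul, norm_sub_I_mul, zpow_add₀ h, zpow_one]
  field_simp

lemma continuous_rho {α : ℝ} (hα : 0 < α) (k : ℤ) : Continuous (rho α k) := by
  unfold rho
  refine Continuous.div ?_ ?_ fun y => zpow_ne_zero _ (sub_I_mul_ne_zero hα y)
  · exact Continuous.zpow₀ (by fun_prop) _ fun y => Or.inl (add_I_mul_ne_zero hα y)
  · exact Continuous.zpow₀ (by fun_prop) _ fun y => Or.inl (sub_I_mul_ne_zero hα y)

lemma rho_eq {α : ℝ} (hα : 0 < α) (k : ℤ) (y : ℝ) :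
    rho α k y = ((α + Complex.I * y) / (α - Complex.I * y)) ^ k / (α - Complex.I * y) := by
  rw [rho, zpow_add₀ (sub_I_mul_ne_zero hα y), zpow_one, div_zpow, div_div]

lemma rho_add_one {α : ℝ} (hα : 0 < α) (k : ℤ) (y : ℝ) :
    rho α (k + 1) y = (α + Complex.I * y) / (α - Complex.I * y) * rho α k y := by
  have h₁ := add_I_mul_ne_zero hα y
  have h₂ := sub_I_mul_ne_zero hα y
  rw [rho_eq hα, rho_eq hα, zpow_add₀ (div_ne_zero h₁ h₂), zpow_one]
  ring

lemma integrable_inv_sq_add_sq {α : ℝ} (hα : 0 < α) :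
    Integrable fun y : ℝ => (α ^ 2 + y ^ 2)⁻¹ := by
  have h := (integrable_inv_one_add_sq.comp_div hα.ne').const_mul (α ^ 2)⁻¹
  refine h.congr (.of_forall fun y => ?_)
  simp only
  field_simp

lemma integral_univ_inv_sq_add_sq {α : ℝ} (hα : 0 < α) :
    ∫ y : ℝ, (α ^ 2 + y ^ 2)⁻¹ = Real.pi / α := by
  have h : ∀ y : ℝ, (α ^ 2 + y ^ 2)⁻¹ = (α ^ 2)⁻¹ * (1 + (y / α) ^ 2)⁻¹ := fun y => by
    field_simp
  simp_rw [h]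
  rw [integral_const_mul, Measure.integral_comp_div (fun y : ℝ => (1 + y ^ 2)⁻¹),
    integral_univ_inv_one_add_sq, abs_of_pos hα, smul_eq_mul]
  field_simp

lemma integrable_rho_div_sub_I_mul {α : ℝ} (hα : 0 < α) (k : ℤ) :
    Integrable fun y : ℝ => rho α k y / (α - Complex.I * y) := by
  have hc : Continuous fun y : ℝ => rho α k y / (α - Complex.I * y) :=
    (continuous_rho hα k).div (by fun_prop) (sub_I_mul_ne_zero hα)
  refine (integrable_inv_sq_add_sq hα).mono' hc.aestronglyMeasurable (.of_forall fun y => ?_)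
  rw [norm_div, norm_rho hα, norm_sub_I_mul, div_eq_mul_inv, ← mul_inv,
    Real.mul_self_sqrt (by positivity)]

lemma tendsto_sub_I_mul_cobounded (α : ℝ) {l : Filter ℝ} (hl : Tendsto (fun y : ℝ => |y|) l atTop) :
    Tendsto (fun y : ℝ => (α : ℂ) - Complex.I * y) l (Bornology.cobounded ℂ) := by
  rw [← tendsto_norm_atTop_iff_cobounded]
  refine tendsto_atTop_mono (fun y => ?_) hl
  rw [norm_sub_I_mul, ← Real.sqrt_sq_eq_abs]
  exact Real.sqrt_le_sqrt (by nlinarith)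

lemma tendsto_cayley {α : ℝ} (hα : 0 < α) {l : Filter ℝ}
    (hl : Tendsto (fun y : ℝ => |y|) l atTop) :
    Tendsto (fun y : ℝ => ((α : ℂ) + Complex.I * y) / (α - Complex.I * y)) l (𝓝 (-1)) := by
  have h := ((tendsto_inv₀_cobounded.comp (tendsto_sub_I_mul_cobounded α hl)).const_mul
    (2 * α : ℂ)).const_add (-1)
  simp only [mul_zero, add_zero] at h
  refine h.congr fun y => ?_
  have := sub_I_mul_ne_zero hα y
  simp only [Function.comp]
  field_simp
  ring

lemma hasDerivAt_cayley {α : ℝ} (hα : 0 < α) (y : ℝ) :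
    HasDerivAt (fun y : ℝ => ((α : ℂ) + Complex.I * y) / (α - Complex.I * y))
      (2 * α * Complex.I / (α - Complex.I * y) ^ 2) y := by
  have hi : HasDerivAt (fun y : ℝ => Complex.I * (y : ℂ)) Complex.I y := by
    simpa using (Complex.ofRealCLM.hasDerivAt (x := y)).const_mul Complex.I
  refine ((hi.const_add (α : ℂ)).div (hi.const_sub (α : ℂ)) (sub_I_mul_ne_zero hα y)).congr_deriv ?_
  ring

lemma integral_rho_div_sub_I_mul {α : ℝ} (hα : 0 < α) (k : ℤ) :
    ∫ y : ℝ, rho α k y / (α - Complex.I * y) = if k = -1 then (Real.pi / α : ℂ) else 0 := by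
  split_ifs with hk
  · subst hk
    have h : ∀ y : ℝ, rho α (-1) y / (α - Complex.I * y) = ((α ^ 2 + y ^ 2)⁻¹ : ℝ) := fun y => by
      have h₁ := add_I_mul_ne_zero hα y
      have h₂ := sub_I_mul_ne_zero hα y
      have h₃ : ((α : ℂ) ^ 2 + y ^ 2) = (α + Complex.I * y) * (α - Complex.I * y) := by
        ring_nf
        simp
      rw [rho_eq hα]
      push_cast
      rw [h₃]
      simp
      field_simp
    simp_rw [h]
    rw [integral_complex_ofReal, integral_univ_inv_sq_add_sq hα]
    simp
  · have hk' : ((k + 1 : ℤ) : ℂ) ≠ 0 := by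
      rw [Int.cast_ne_zero]
      omega
    have hα' : (α : ℂ) ≠ 0 := by exact_mod_cast hα.ne'
    have hlim {l : Filter ℝ} (hl : Tendsto (fun y : ℝ => |y|) l atTop) :=
      ((tendsto_cayley hα hl).zpow₀ (k + 1) (Or.inl (by simp))).const_mul
        (((k + 1 : ℤ) : ℂ) * (2 * α * Complex.I))⁻¹
    rw [integral_of_hasDerivAt_of_tendsto (fun y => ?_) (integrable_rho_div_sub_I_mul hα k)
      (hlim tendsto_abs_atBot_atTop) (hlim tendsto_abs_atTop_atTop), sub_self]
    have h₁ := add_I_mul_ne_zero hα y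
    have h₂ := sub_I_mul_ne_zero hα y
    refine (((hasDerivAt_zpow (k + 1) _ (Or.inl (div_ne_zero h₁ h₂))).comp y
      (hasDerivAt_cayley hα y)).const_mul _).congr_deriv ?_
    rw [rho_eq hα, add_sub_cancel_right]
    have := Complex.I_ne_zero
    field_simp

lemma aecover_lt_abs_sub (x : ℝ) :
    AECover volume (𝓝[>] (0 : ℝ)) fun ε => {y : ℝ | ε < |x - y|} where
  ae_eventually_mem := by
    filter_upwards [Measure.ae_ne volume x] with y hy
    exact nhdsWithin_le_nhds (Iio_mem_nhds (abs_pos.mpr (sub_ne_zero.mpr hy.symm)))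
  measurableSet ε := measurableSet_lt measurable_const (by fun_prop)

lemma integrableOn_rho_div_sub {α : ℝ} (hα : 0 < α) (k : ℤ) (x : ℝ) {ε : ℝ} (hε : 0 < ε) :
    IntegrableOn (fun y : ℝ => rho α k y / ((x - y : ℝ) : ℂ)) {y : ℝ | ε < |x - y|} := by
  have hm : AEStronglyMeasurable (fun y : ℝ => rho α k y / ((x - y : ℝ) : ℂ))
      (volume.restrict {y : ℝ | ε < |x - y|}) :=
    ((continuous_rho hα k).measurable.div (by fun_prop)).aestronglyMeasurable
  have hb := ((integrable_inv_sq_add_sq hα).add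
    (((integrable_inv_sq_add_sq hε).comp_sub_left x).const_mul 2)).integrableOn
      (s := {y : ℝ | ε < |x - y|})
  refine Integrable.mono' hb hm ?_
  filter_upwards [ae_restrict_mem ((aecover_lt_abs_sub x).measurableSet ε)] with y hy
  have hy : ε < |x - y| := hy
  have hpos : 0 < |x - y| := hε.trans hy
  have hsq : (√(α ^ 2 + y ^ 2))⁻¹ ^ 2 = (α ^ 2 + y ^ 2)⁻¹ := by
    rw [inv_pow, Real.sq_sqrt (by positivity)]
  have hle : |x - y|⁻¹ ^ 2 ≤ 2 * (ε ^ 2 + (x - y) ^ 2)⁻¹ := by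
    rw [← sq_abs (x - y), inv_pow, ← div_eq_mul_inv, inv_eq_one_div,
      div_le_div_iff₀ (by positivity) (by positivity)]
    nlinarith
  rw [norm_div, norm_rho hα, Complex.norm_real, Real.norm_eq_abs, div_eq_mul_inv]
  simp only [Pi.add_apply]
  rw [← hsq]
  nlinarith [sq_nonneg ((√(α ^ 2 + y ^ 2))⁻¹ - |x - y|⁻¹), sq_nonneg (√(α ^ 2 + y ^ 2))⁻¹,
    sq_nonneg |x - y|⁻¹]

lemma setIntegral_rho_add_one {α : ℝ} (hα : 0 < α) (k : ℤ) (x : ℝ) {ε : ℝ} (hε : 0 < ε) :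
    ∫ y in {y : ℝ | ε < |x - y|}, rho α (k + 1) y / ((x - y : ℝ) : ℂ) =
      (α + Complex.I * x) / (α - Complex.I * x) *
          (∫ y in {y : ℝ | ε < |x - y|}, rho α k y / ((x - y : ℝ) : ℂ)) -
        2 * α * Complex.I / (α - Complex.I * x) *
          ∫ y in {y : ℝ | ε < |x - y|}, rho α k y / (α - Complex.I * y) := by
  rw [← integral_const_mul, ← integral_const_mul, ← integral_sub
    ((integrableOn_rho_div_sub hα k x hε).const_mul _)
    ((integrable_rho_div_sub_I_mul hα k).integrableOn.const_mul _)]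
  refine setIntegral_congr_fun ((aecover_lt_abs_sub x).measurableSet ε) fun y hy => ?_
  have hxy : ((x : ℂ) - y) ≠ 0 := by
    exact_mod_cast abs_pos.mp (hε.trans hy)
  have h₁ := sub_I_mul_ne_zero hα x
  have h₂ := sub_I_mul_ne_zero hα y
  simp only [rho_add_one hα]
  push_cast
  field_simp
  ring

/-- An antiderivative of `1 / (x - y) - i / (α - i y)`. -/
noncomputable def hilbertPrimitive (α x y : ℝ) : ℂ :=
  ((Real.log (α ^ 2 + y ^ 2) / 2 - Real.log (x - y) : ℝ) : ℂ) -
    Complex.I * (Real.arctan (y / α) : ℝ)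

lemma hasDerivAt_hilbertPrimitive {α : ℝ} (hα : 0 < α) {x y : ℝ} (hy : y ≠ x) :
    HasDerivAt (hilbertPrimitive α x)
      ((α - Complex.I * x) * (rho α 0 y / ((x - y : ℝ) : ℂ))) y := by
  have hxy : x - y ≠ 0 := sub_ne_zero.mpr hy.symm
  have hlog : HasDerivAt (fun y : ℝ => Real.log (α ^ 2 + y ^ 2) / 2 - Real.log (x - y))
      (y / (α ^ 2 + y ^ 2) + 1 / (x - y)) y := by
    refine ((((hasDerivAt_pow 2 y).const_add (α ^ 2)).log (by positivity)).div_const 2 |>.sub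
      (((hasDerivAt_id y).const_sub x).log hxy)).congr_deriv ?_
    simp only [id]
    field_simp
    ring
  have harctan : HasDerivAt (fun y : ℝ => Real.arctan (y / α)) (α / (α ^ 2 + y ^ 2)) y := by
    refine (((hasDerivAt_id y).div_const α).arctan).congr_deriv ?_
    simp only [id]
    field_simp
  refine (hlog.ofReal_comp.sub (harctan.ofReal_comp.const_mul Complex.I)).congr_deriv ?_
  have h₁ := add_I_mul_ne_zero hα y
  have h₂ := sub_I_mul_ne_zero hα y
  have h₃ : ((α : ℂ) ^ 2 + y ^ 2) = (α + Complex.I * y) * (α - Complex.I * y) := by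
    ring_nf
    simp
  have hxy' : ((x : ℂ) - y) ≠ 0 := by exact_mod_cast hxy
  rw [rho_eq hα, zpow_zero]
  push_cast
  rw [h₃]
  rw [mul_comm Complex.I] at h₁ h₂
  field_simp
  ring_nf
  simp only [Complex.I_sq]
  ring

lemma tendsto_log_sub_log {l : Filter ℝ} (α x : ℝ) (hl : Tendsto (fun y : ℝ => |y|) l atTop) :
    Tendsto (fun y : ℝ => Real.log (α ^ 2 + y ^ 2) / 2 - Real.log (x - y)) l (𝓝 0) := by
  have hinv : Tendsto (fun y : ℝ => y⁻¹) l (𝓝 0) :=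
    tendsto_inv₀_cobounded.comp (tendsto_norm_atTop_iff_cobounded.mp hl)
  have h : Tendsto (fun y : ℝ => Real.log ((α * y⁻¹) ^ 2 + 1) / 2 - Real.log (x * y⁻¹ - 1)) l
      (𝓝 0) := by
    have := ((((hinv.const_mul α).pow 2).add_const 1).log (by simp)).div_const 2 |>.sub
      (((hinv.const_mul x).sub_const 1).log (by simp))
    simpa using this
  refine h.congr' ?_
  filter_upwards [hl.eventually_gt_atTop 0, hl.eventually_gt_atTop |x|] with y hy hxy
  have hy : y ≠ 0 := abs_pos.mp hy
  have hxy : x - y ≠ 0 := fun h => by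
    rw [sub_eq_zero.mp h] at hxy
    exact lt_irrefl _ hxy
  have e₁ : (α * y⁻¹) ^ 2 + 1 = (α ^ 2 + y ^ 2) / y ^ 2 := by field_simp
  have e₂ : x * y⁻¹ - 1 = (x - y) / y := by field_simp
  rw [e₁, e₂, Real.log_div (by positivity) (by positivity), Real.log_div hxy hy, Real.log_pow]
  push_cast
  ring

lemma tendsto_hilbertPrimitive_atTop {α : ℝ} (hα : 0 < α) (x : ℝ) :
    Tendsto (hilbertPrimitive α x) atTop (𝓝 (-Complex.I * (Real.pi / 2 : ℝ))) := by
  have ha := (Real.tendsto_arctan_atTop.mono_right nhdsWithin_le_nhds).comp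
    (tendsto_id.atTop_div_const hα)
  have := ((Complex.continuous_ofReal.tendsto _).comp
    (tendsto_log_sub_log α x tendsto_abs_atTop_atTop)).sub
    (((Complex.continuous_ofReal.tendsto _).comp ha).const_mul Complex.I)
  unfold hilbertPrimitive
  simpa [Function.comp_def] using this

lemma tendsto_hilbertPrimitive_atBot {α : ℝ} (hα : 0 < α) (x : ℝ) :
    Tendsto (hilbertPrimitive α x) atBot (𝓝 (Complex.I * (Real.pi / 2 : ℝ))) := by
  have ha := (Real.tendsto_arctan_atBot.mono_right nhdsWithin_le_nhds).comp
    (tendsto_id.atBot_div_const hα)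
  have := ((Complex.continuous_ofReal.tendsto _).comp
    (tendsto_log_sub_log α x tendsto_abs_atBot_atTop)).sub
    (((Complex.continuous_ofReal.tendsto _).comp ha).const_mul Complex.I)
  unfold hilbertPrimitive
  simpa [Function.comp_def, neg_div] using this

lemma setOf_lt_abs_sub (x ε : ℝ) :
    {y : ℝ | ε < |x - y|} = Set.Iio (x - ε) ∪ Set.Ioi (x + ε) := by
  ext y
  simp only [Set.mem_ofPred_eq, lt_abs, Set.mem_union, Set.mem_Iio, Set.mem_Ioi]
  constructor <;> rintro (h | h) <;> [left; right; left; right] <;> linarith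

lemma setIntegral_rho_zero {α : ℝ} (hα : 0 < α) (x : ℝ) {ε : ℝ} (hε : 0 < ε) :
    (α - Complex.I * x) * ∫ y in {y : ℝ | ε < |x - y|}, rho α 0 y / ((x - y : ℝ) : ℂ) =
      hilbertPrimitive α x (x - ε) - hilbertPrimitive α x (x + ε) - Complex.I * Real.pi := by
  have hint : IntegrableOn (fun y : ℝ => (α - Complex.I * x) * (rho α 0 y / ((x - y : ℝ) : ℂ)))
      {y : ℝ | ε < |x - y|} :=
    (integrableOn_rho_div_sub hα 0 x hε).const_mul (α - Complex.I * x)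
  rw [← integral_const_mul]
  rw [setOf_lt_abs_sub] at hint ⊢
  have hl := hint.mono_set Set.subset_union_left
  have hr := hint.mono_set Set.subset_union_right
  rw [← integrableOn_Iic_iff_integrableOn_Iio] at hl
  have hd : Disjoint (Set.Iio (x - ε)) (Set.Ioi (x + ε)) :=
    Set.disjoint_left.mpr fun y h₁ h₂ => by
      rw [Set.mem_Iio] at h₁
      rw [Set.mem_Ioi] at h₂
      linarith
  rw [setIntegral_union hd measurableSet_Ioi (hint.mono_set Set.subset_union_left) hr,
    ← integral_Iic_eq_integral_Iio,
    integral_Iic_of_hasDerivAt_of_tendsto'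
      (fun y hy => hasDerivAt_hilbertPrimitive hα (by rw [Set.mem_Iic] at hy; linarith))
      hl (tendsto_hilbertPrimitive_atBot hα x),
    integral_Ioi_of_hasDerivAt_of_tendsto'
      (fun y hy => hasDerivAt_hilbertPrimitive hα (by rw [Set.mem_Ici] at hy; linarith))
      hr (tendsto_hilbertPrimitive_atTop hα x)]
  push_cast
  ring

lemma tendsto_hilbertPrimitive_sub {α : ℝ} (hα : 0 < α) (x : ℝ) :
    Tendsto (fun ε : ℝ => hilbertPrimitive α x (x - ε) - hilbertPrimitive α x (x + ε))
      (𝓝 0) (𝓝 0) := by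
  have hc : Continuous fun y : ℝ =>
      ((Real.log (α ^ 2 + y ^ 2) / 2 : ℝ) : ℂ) - Complex.I * (Real.arctan (y / α) : ℝ) := by
    have : Continuous fun y : ℝ => Real.log (α ^ 2 + y ^ 2) :=
      Continuous.log (by fun_prop) fun y => by positivity
    have := Real.continuous_arctan
    fun_prop
  have h := ((hc.comp ((continuous_const (y := x)).sub continuous_id)).sub
    (hc.comp ((continuous_const (y := x) (X := ℝ)).add continuous_id))).tendsto' 0 0 (by simp)
  refine h.congr fun ε => ?_
  simp [hilbertPrimitive]
  ring

lemma tendsto_setIntegral_rho_zero {α : ℝ} (hα : 0 < α) (x : ℝ) :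
    Tendsto (fun ε : ℝ => ∫ y in {y : ℝ | ε < |x - y|}, rho α 0 y / ((x - y : ℝ) : ℂ))
      (𝓝[>] 0) (𝓝 (-Complex.I * Real.pi * rho α 0 x)) := by
  have hx := sub_I_mul_ne_zero hα x
  have h := (((tendsto_hilbertPrimitive_sub hα x).mono_left (nhdsWithin_le_nhds (s := Set.Ioi 0))).sub_const
    (Complex.I * Real.pi)).const_mul ((α : ℂ) - Complex.I * x)⁻¹
  have e : ((α : ℂ) - Complex.I * x)⁻¹ * (0 - Complex.I * Real.pi) =
      -Complex.I * Real.pi * rho α 0 x := by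
    rw [rho_eq hα, zpow_zero]
    ring
  rw [e] at h
  refine h.congr' ?_
  filter_upwards [self_mem_nhdsWithin] with ε hε
  rw [← setIntegral_rho_zero hα x hε, inv_mul_cancel_left₀ hx]

lemma tendsto_setIntegral_rho_div_sub_I_mul {α : ℝ} (hα : 0 < α) (k : ℤ) (x : ℝ) :
    Tendsto (fun ε : ℝ => ∫ y in {y : ℝ | ε < |x - y|}, rho α k y / (α - Complex.I * y))
      (𝓝[>] 0) (𝓝 (if k = -1 then (Real.pi / α : ℂ) else 0)) := by
  rw [← integral_rho_div_sub_I_mul hα k]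
  exact (aecover_lt_abs_sub x).integral_tendsto_of_countably_generated
    (integrable_rho_div_sub_I_mul hα k)

lemma hilbert_eigenvalue_add_one {α : ℝ} (hα : 0 < α) (k : ℤ) (x : ℝ) :
    -Complex.I * (Real.pi : ℂ) * (if 0 ≤ k + 1 then 1 else -1) * rho α (k + 1) x =
      (α + Complex.I * x) / (α - Complex.I * x) *
          (-Complex.I * (Real.pi : ℂ) * (if 0 ≤ k then 1 else -1) * rho α k x) -
        2 * α * Complex.I / (α - Complex.I * x) * (if k = -1 then (Real.pi / α : ℂ) else 0) := by
  have h₁ := add_I_mul_ne_zero hα x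
  have h₂ := sub_I_mul_ne_zero hα x
  have hα' : (α : ℂ) ≠ 0 := by exact_mod_cast hα.ne'
  rw [rho_add_one hα]
  rcases eq_or_ne k (-1) with rfl | hk
  · rw [rho_eq hα]
    simp
    field_simp
    ring
  · have : (0 ≤ k + 1) ↔ (0 ≤ k) := by omega
    simp only [this, hk, if_false]
    ring

/-- The rational basis functions are eigenfunctions of the principal-value Hilbert
transform: the truncated singular integrals
`∫_{|x - y| > ε} ρ_k(y)/(x - y) dy` converge, as `ε → 0⁺`, to
`-i π σ(k) ρ_k(x)`, where `σ(k) = 1` for `k ≥ 0` and `σ(k) = -1` for `k < 0`. -/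
theorem rho_hilbert_eigenfunction (α : ℝ) (hα : 0 < α) (k : ℤ) (x : ℝ) :
    Tendsto
      (fun ε : ℝ => ∫ y in {y : ℝ | ε < |x - y|}, rho α k y / ((x - y : ℝ) : ℂ))
      (nhdsWithin 0 (Set.Ioi 0))
      (nhds (-Complex.I * (Real.pi : ℂ) * (if 0 ≤ k then 1 else -1) * rho α k x)) := by
  have hw := div_ne_zero (add_I_mul_ne_zero hα x) (sub_I_mul_ne_zero hα x)
  have hJ (k : ℤ) := (tendsto_setIntegral_rho_div_sub_I_mul hα k x).const_mul
    (2 * α * Complex.I / (α - Complex.I * x))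
  induction k using Int.induction_on with
  | zero => simpa using tendsto_setIntegral_rho_zero hα x
  | succ k ih =>
    rw [hilbert_eigenvalue_add_one hα]
    refine ((ih.const_mul _).sub (hJ k)).congr' ?_
    filter_upwards [self_mem_nhdsWithin] with ε hε
    rw [setIntegral_rho_add_one hα _ x hε]
  | pred k ih =>
    have hk : (-(k : ℤ)) = (-k - 1) + 1 := by ring
    rw [hk, hilbert_eigenvalue_add_one hα] at ih
    have h := (ih.add (hJ (-k - 1))).const_mul
      (((α : ℂ) + Complex.I * x) / (α - Complex.I * x))⁻¹
    rw [sub_add_cancel (_ * _), inv_mul_cancel_left₀ hw] at h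
    refine h.congr' ?_
    filter_upwards [self_mem_nhdsWithin] with ε hε
    rw [setIntegral_rho_add_one hα _ x hε, sub_add_cancel, inv_mul_cancel_left₀ hw]
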